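/- Let W be the Weierstrass curve over the field with 2 elements given by the coefficients a₁ = 0, a₂ = 0, a₃ = 1, a₄ = 1, a₆ = 1, i.e., the elliptic curve y² + y = x³ + x + 1 over F₂, and let R = F₂[X, Y]/(Y² + Y − (X³ + X + 1)) be its affine coordinate ring. Then the ideal class group of R is trivial (it has exactly one element). -/

import Mathlib

open MvPolynomial in
/-- The affine coordinate ring `F[X, Y] ⧸ (Y² + Y - (X³ + X + 1))` of the elliptic curve
`y² + y = x³ + x + 1` over a field `F`, with `X := X 0` and `Y := X 1`. -/
abbrev heckeCoordRing (F : Type*) [Field F] : Type _ :=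
  MvPolynomial (Fin 2) F ⧸
    Ideal.span {(X 1 : MvPolynomial (Fin 2) F) ^ 2 + X 1 - ((X 0) ^ 3 + X 0 + 1)}

open Polynomial in
/-- The Weierstrass curve `y² + y = x³ + x + 1` over `F₂`. -/
noncomputable def heckeW : WeierstrassCurve.Affine (ZMod 2) := ⟨0, 0, 1, 1, 1⟩

open Polynomial WeierstrassCurve.Affine in
theorem heckeW_finite (I : Ideal heckeW.CoordinateRing) (hI : I ≠ ⊥) :
    FiniteDimensional (ZMod 2) (heckeW.CoordinateRing ⧸ I) := by
  have e := Ideal.quotientEquivDirectSum (ZMod 2) (CoordinateRing.basis heckeW) hI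
  have (i : Fin 2) : FiniteDimensional (ZMod 2) ((ZMod 2)[X] ⧸
      Ideal.span ({I.smithCoeffs (CoordinateRing.basis heckeW) hI i} : Set (ZMod 2)[X])) :=
    PowerBasis.finite <| AdjoinRoot.powerBasis <| I.smithCoeffs_ne_zero _ hI i
  have e2 := e.trans (DirectSum.linearEquivFunOnFintype (ZMod 2) (Fin 2) _)
  exact Module.Finite.equiv e2.symm

open Polynomial WeierstrassCurve.Affine in
/-- Riemann–Roch style count: a proper nonzero ideal of codimension `n` contains a nonzero
element whose norm has degree at most `n + 1`. -/
theorem heckeW_exists (I : Ideal heckeW.CoordinateRing) (hI : I ≠ ⊥) (hT : I ≠ ⊤) :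
    ∃ f ∈ I, f ≠ 0 ∧ (Algebra.norm (ZMod 2)[X] f).natDegree ≤
      Module.finrank (ZMod 2) (heckeW.CoordinateRing ⧸ I) + 1 := by
  have := heckeW_finite I hI
  set n := Module.finrank (ZMod 2) (heckeW.CoordinateRing ⧸ I) with hn
  have hpos : 0 < n := by
    have : Nontrivial (heckeW.CoordinateRing ⧸ I) := Ideal.Quotient.nontrivial_iff.2 hT
    exact Module.finrank_pos
  obtain ⟨a, b, hab, ha, hb⟩ : ∃ a b : ℕ, a + b = n + 1 ∧ 2 * a ≤ n + 3 ∧ 2 * b ≤ n := by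
    exact ⟨(n + 1) / 2 + 1, n - (n + 1) / 2, by lia, by lia, by lia⟩
  let L : (degreeLT (ZMod 2) a × degreeLT (ZMod 2) b) →ₗ[ZMod 2] heckeW.CoordinateRing :=
    { toFun := fun v => v.1.1 • (1 : heckeW.CoordinateRing) + v.2.1 • CoordinateRing.mk heckeW X
      map_add' := by
        intro u v
        simp only [Prod.fst_add, Prod.snd_add, Submodule.coe_add, add_smul]
        abel
      map_smul' := by
        intro c v
        simp only [Prod.smul_fst, Prod.smul_snd, Submodule.coe_smul, smul_assoc, smul_add,
          RingHom.id_apply] }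
  let Q : heckeW.CoordinateRing →ₗ[ZMod 2] (heckeW.CoordinateRing ⧸ I) :=
    (Ideal.Quotient.mkₐ (ZMod 2) I).toLinearMap
  have fa : Module.Finite (ZMod 2) (degreeLT (ZMod 2) a) :=
    Module.Finite.equiv (degreeLTEquiv (ZMod 2) a).symm
  have fb : Module.Finite (ZMod 2) (degreeLT (ZMod 2) b) :=
    Module.Finite.equiv (degreeLTEquiv (ZMod 2) b).symm
  have hk : LinearMap.ker (Q ∘ₗ L) ≠ ⊥ := by
    apply LinearMap.ker_ne_bot_of_finrank_lt
    rw [Module.finrank_prod, (degreeLTEquiv (ZMod 2) a).finrank_eq,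
      (degreeLTEquiv (ZMod 2) b).finrank_eq]
    simp only [Module.finrank_fin_fun]
    lia
  obtain ⟨v, hv, hv0⟩ := Submodule.exists_mem_ne_zero_of_ne_bot hk
  obtain ⟨⟨p, hp⟩, ⟨q, hq⟩⟩ := v
  refine ⟨p • 1 + q • CoordinateRing.mk heckeW X, ?_, ?_, ?_⟩
  · exact Ideal.Quotient.eq_zero_iff_mem.1 hv
  · intro h0
    obtain ⟨rfl, rfl⟩ := CoordinateRing.smul_basis_eq_zero h0
    exact hv0 rfl
  · rw [natDegree_le_iff_degree_le, CoordinateRing.degree_norm_smul_basis]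
    rw [mem_degreeLT] at hp hq
    apply max_le
    · by_cases h : p = 0
      · simp [h]
      · rw [degree_eq_natDegree h] at hp ⊢
        have : p.natDegree < a := by exact_mod_cast hp
        have h2 : 2 * p.natDegree ≤ n + 1 := by lia
        rw [nsmul_eq_mul]
        exact_mod_cast h2
    · by_cases h : q = 0
      · simp [h]
      · rw [degree_eq_natDegree h] at hq ⊢
        have : q.natDegree < b := by exact_mod_cast hq
        have h2 : 2 * q.natDegree + 3 ≤ n + 1 := by lia
        rw [nsmul_eq_mul]
        exact_mod_cast h2

open Polynomial WeierstrassCurve.Affine in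
theorem heckeW_polynomial : heckeW.polynomial =
    (X : (ZMod 2)[X][X]) ^ 2 + X - (C X ^ 3 + C X + 1) := by
  simp [WeierstrassCurve.Affine.polynomial, heckeW]

open Polynomial WeierstrassCurve.Affine in
theorem heckeW_eqn : (CoordinateRing.mk heckeW X) ^ 2 + CoordinateRing.mk heckeW X =
    (CoordinateRing.mk heckeW (C X)) ^ 3 + CoordinateRing.mk heckeW (C X) + 1 := by
  have h : CoordinateRing.mk heckeW heckeW.polynomial = 0 := AdjoinRoot.mk_self
  replace h := (congrArg (CoordinateRing.mk heckeW) heckeW_polynomial).symm.trans h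
  rw [map_sub, map_add, map_add, map_add, map_pow, map_pow, map_one] at h
  linear_combination h

open Polynomial WeierstrassCurve.Affine in
theorem heckeW_pid : IsPrincipalIdealRing heckeW.CoordinateRing := by
  refine ⟨fun I => ?_⟩
  by_cases hI : I = ⊥
  · rw [hI]; infer_instance
  by_cases hT : I = ⊤
  · rw [hT]; infer_instance
  obtain ⟨f, hfI, hf0, hdeg⟩ := heckeW_exists I hI hT
  rw [← finrank_quotient_span_eq_natDegree_norm (CoordinateRing.basis heckeW) hf0] at hdeg
  set J : Ideal heckeW.CoordinateRing := Ideal.span {f} with hJ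
  have hJ0 : J ≠ ⊥ := by simpa [hJ] using hf0
  have := heckeW_finite I hI
  have := heckeW_finite J hJ0
  have hJI : J ≤ I := by simpa [hJ, Ideal.span_le] using hfI
  let φ : (heckeW.CoordinateRing ⧸ J) →ₗ[ZMod 2] (heckeW.CoordinateRing ⧸ I) :=
    (Ideal.Quotient.factorₐ (ZMod 2) hJI).toLinearMap
  have hφ : Function.Surjective φ := Ideal.Quotient.factor_surjective hJI
  have hrk := LinearMap.finrank_range_add_finrank_ker φ
  rw [LinearMap.range_eq_top.2 hφ, finrank_top] at hrk
  have hker : Module.finrank (ZMod 2) (LinearMap.ker φ) ≤ 1 := by lia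
  obtain ⟨⟨v, hvk⟩, hv⟩ := finrank_le_one_iff.1 hker
  have key : ∀ w ∈ I, ∃ c : ZMod 2, c • v = Ideal.Quotient.mk J w := by
    intro w hw
    have hwk : Ideal.Quotient.mk J w ∈ LinearMap.ker φ := by
      rw [LinearMap.mem_ker]
      exact Ideal.Quotient.eq_zero_iff_mem.2 hw
    obtain ⟨c, hc⟩ := hv ⟨_, hwk⟩
    exact ⟨c, congrArg Subtype.val hc⟩
  obtain ⟨g, rfl⟩ := Ideal.Quotient.mk_surjective v
  have hg : g ∈ I := Ideal.Quotient.eq_zero_iff_mem.1 hvk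
  suffices hgJ : Ideal.Quotient.mk J g = 0 by
    refine ⟨f, ?_⟩
    refine le_antisymm (fun w hw => ?_) hJI
    obtain ⟨c, hc⟩ := key w hw
    rw [hgJ, smul_zero] at hc
    exact Ideal.Quotient.eq_zero_iff_mem.1 hc.symm
  obtain ⟨a, ha⟩ := key (CoordinateRing.mk heckeW (C X) * g) (I.mul_mem_left _ hg)
  obtain ⟨b, hb⟩ := key (CoordinateRing.mk heckeW X * g) (I.mul_mem_left _ hg)
  have heq := congrArg (Ideal.Quotient.mk J) heckeW_eqn
  rw [map_mul, Algebra.smul_def] at ha hb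
  simp only [map_add, map_pow, map_one] at heq
  have h2 : (2 : heckeW.CoordinateRing ⧸ J) = 0 := by
    have : algebraMap (ZMod 2) (heckeW.CoordinateRing ⧸ J) 2 = 0 := by
      rw [show (2 : ZMod 2) = 0 from rfl, map_zero]
    rwa [map_ofNat] at this
  have hab : ∀ c : ZMod 2, c = 0 ∨ c = 1 := by decide
  generalize Ideal.Quotient.mk J g = G at *
  generalize Ideal.Quotient.mk J (CoordinateRing.mk heckeW (C X)) = x at *
  generalize Ideal.Quotient.mk J (CoordinateRing.mk heckeW X) = y at *
  have e1 : (y ^ 2 + y) * G = 0 := by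
    rcases hab b with rfl | rfl
    · rw [map_zero] at hb
      linear_combination (-(y + 1)) * hb
    · rw [map_one] at hb
      linear_combination (-(y + 2)) * hb + G * h2
  have e2 : (x ^ 3 + x) * G = 0 := by
    rcases hab a with rfl | rfl
    · rw [map_zero] at ha
      linear_combination (-(x ^ 2 + 1)) * ha
    · rw [map_one] at ha
      linear_combination (-(x ^ 2 + x + 2)) * ha + G * h2
  linear_combination e1 - e2 - G * heq

open Polynomial WeierstrassCurve.Affine in
theorem heckeCoordRing_pid : IsPrincipalIdealRing (heckeCoordRing (ZMod 2)) := by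
  have := heckeW_pid
  let q := Ideal.Quotient.mk (Ideal.span {(MvPolynomial.X 1 : MvPolynomial (Fin 2) (ZMod 2)) ^ 2
    + MvPolynomial.X 1 - ((MvPolynomial.X 0) ^ 3 + MvPolynomial.X 0 + 1)})
  have hrel : q (MvPolynomial.X 1) ^ 2 + q (MvPolynomial.X 1)
      - (q (MvPolynomial.X 0) ^ 3 + q (MvPolynomial.X 0) + 1) = 0 := by
    have : q ((MvPolynomial.X 1 : MvPolynomial (Fin 2) (ZMod 2)) ^ 2
      + MvPolynomial.X 1 - ((MvPolynomial.X 0) ^ 3 + MvPolynomial.X 0 + 1)) = 0 :=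
      Ideal.Quotient.eq_zero_iff_mem.2 (Ideal.subset_span rfl)
    simpa using this
  let i : (ZMod 2)[X] →+* heckeCoordRing (ZMod 2) :=
    eval₂RingHom (q.comp MvPolynomial.C) (q (MvPolynomial.X 0))
  have hroot : heckeW.polynomial.eval₂ i (q (MvPolynomial.X 1)) = 0 := by
    rw [heckeW_polynomial, eval₂_sub, eval₂_add, eval₂_add, eval₂_add, eval₂_pow, eval₂_pow,
      eval₂_one, eval₂_X, eval₂_C]
    have hi : i X = q (MvPolynomial.X 0) := by simp [i]
    rw [hi]
    linear_combination hrel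
  let Φ : heckeW.CoordinateRing →+* heckeCoordRing (ZMod 2) :=
    AdjoinRoot.lift i (q (MvPolynomial.X 1)) hroot
  refine IsPrincipalIdealRing.of_surjective Φ ?_
  intro z
  obtain ⟨z, rfl⟩ := Ideal.Quotient.mk_surjective z
  change ∃ a, Φ a = q z
  induction z using MvPolynomial.induction_on with
  | C c =>
    refine ⟨AdjoinRoot.of _ (C c), ?_⟩
    simp [Φ, i]
  | add s t hs ht =>
    obtain ⟨s', hs⟩ := hs
    obtain ⟨t', ht⟩ := ht
    exact ⟨s' + t', by rw [map_add, map_add, hs, ht]⟩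
  | mul_X s j hs =>
    obtain ⟨s', hs⟩ := hs
    have hj : ∃ u, Φ u = q (MvPolynomial.X j) := by
      fin_cases j
      · exact ⟨AdjoinRoot.of _ X, by simp [Φ, i]⟩
      · exact ⟨AdjoinRoot.root _, by simp [Φ]⟩
    obtain ⟨u, hu⟩ := hj
    exact ⟨s' * u, by rw [map_mul, map_mul, hs, hu]⟩

/-- Let `R = F₂[X, Y] ⧸ (Y² + Y - (X³ + X + 1))` be the affine coordinate
ring of the elliptic curve `y² + y = x³ + x + 1` over `F₂`. Then the ideal class group of
`R` is trivial: it has exactly one element. -/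
theorem heckeCoordRing_F2_classGroup_trivial [IsDomain (heckeCoordRing (ZMod 2))] :
    Nat.card (ClassGroup (heckeCoordRing (ZMod 2))) = 1 := by
  have := heckeCoordRing_pid
  rw [Nat.card_eq_fintype_card, card_classGroup_eq_one]
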